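/- arXiv:2006.15068 — 5 statements merged into one kernel-verified Lean document; each statement's English description precedes it below -/
import Mathlib

section
/- Let k be a natural number, n : Fin k → ℕ, σ a permutation of Fin k, N = ∑_{t : Fin k} n(t), and for each ℓ : Fin k let π(ℓ) be a permutation of Fin (n(ℓ)). Let τ be the permutation of Fin N satisfying τ((∑_{t < ℓ} n(t)) + m) = (∑_{t : σ(t) < σ(ℓ)} n(t)) + m for all ℓ : Fin k and m < n(ℓ). Let β be a permutation of Fin N satisfying β((∑_{t < ℓ} n(t)) + m) = (∑_{t < ℓ} n(t)) + π(ℓ)(m) for all ℓ : Fin k and m < n(ℓ), and let β' be a permutation of Fin N satisfying β'((∑_{t < ℓ} n(σ⁻¹(t))) + m) = (∑_{t < ℓ} n(σ⁻¹(t))) + π(σ⁻¹(ℓ))(m) for all ℓ : Fin k and m < n(σ⁻¹(ℓ)). Then τ ∘ β = β' ∘ τ as permutations of Fin N. -/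
/-- Every natural number below a finite sum lies in one of its consecutive blocks. -/
theorem exists_eq_sum_filter_lt_add {ι : Type*} [LinearOrder ι] (n : ι → ℕ) (s : Finset ι)
    {i : ℕ} (hi : i < ∑ t ∈ s, n t) :
    ∃ ℓ ∈ s, ∃ m < n ℓ, i = (∑ t ∈ s.filter (fun t => t < ℓ), n t) + m := by
  induction s using Finset.induction_on_max with
  | empty => simp at hi
  | insert a s ha ih =>
    have has : a ∉ s := fun h => lt_irrefl a (ha a h)
    by_cases h : i < ∑ t ∈ s, n t
    · obtain ⟨ℓ, hℓ, m, hm, rfl⟩ := ih h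
      refine ⟨ℓ, Finset.mem_insert_of_mem hℓ, m, hm, ?_⟩
      rw [Finset.filter_insert, if_neg (ha ℓ hℓ).not_gt]
    · rw [Finset.sum_insert has] at hi
      refine ⟨a, Finset.mem_insert_self a s, i - ∑ t ∈ s, n t, by omega, ?_⟩
      rw [Finset.filter_insert, if_neg (lt_irrefl a), Finset.filter_true_of_mem ha]
      omega

/-- A block of a finite sum, together with the blocks preceding it in the order pulled back
along `f`, fits inside the total sum. -/
theorem sum_filter_lt_add_lt {ι κ : Type*} [Fintype ι] [LinearOrder κ] (f : ι → κ) (n : ι → ℕ)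
    (ℓ : ι) {m : ℕ} (hm : m < n ℓ) :
    (∑ t ∈ Finset.univ.filter (fun t => f t < f ℓ), n t) + m < ∑ t, n t := by
  classical
  have hℓ : ℓ ∉ Finset.univ.filter (fun t => f t < f ℓ) := by simp
  have h := Finset.sum_le_sum_of_subset (f := n)
    (Finset.subset_univ (insert ℓ (Finset.univ.filter (fun t => f t < f ℓ))))
  rw [Finset.sum_insert hℓ] at h
  omega

/-- Compatibility of block shuffles with block sums:
`σ_(n₁,…,n_k) ∘ (π₁×⋯×π_k) = (π_{σ⁻¹(1)}×⋯×π_{σ⁻¹(k)}) ∘ σ_(n₁,…,n_k)`. -/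
theorem blockShuffle_comp_blockSum (k : ℕ) (n : Fin k → ℕ) (σ : Equiv.Perm (Fin k))
    (N : ℕ) (hN : N = ∑ t, n t) (π : ∀ ℓ : Fin k, Equiv.Perm (Fin (n ℓ)))
    (τ β β' : Equiv.Perm (Fin N))
    (hτ : ∀ (ℓ : Fin k) (m : ℕ) (_hm : m < n ℓ)
      (h1 : (∑ t ∈ Finset.univ.filter (fun t => t < ℓ), n t) + m < N),
      (τ ⟨(∑ t ∈ Finset.univ.filter (fun t => t < ℓ), n t) + m, h1⟩ : ℕ) =
        (∑ t ∈ Finset.univ.filter (fun t => σ t < σ ℓ), n t) + m)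
    (hβ : ∀ (ℓ : Fin k) (m : ℕ) (hm : m < n ℓ)
      (h1 : (∑ t ∈ Finset.univ.filter (fun t => t < ℓ), n t) + m < N),
      (β ⟨(∑ t ∈ Finset.univ.filter (fun t => t < ℓ), n t) + m, h1⟩ : ℕ) =
        (∑ t ∈ Finset.univ.filter (fun t => t < ℓ), n t) + (π ℓ ⟨m, hm⟩ : ℕ))
    (hβ' : ∀ (ℓ : Fin k) (m : ℕ) (hm : m < n (σ⁻¹ ℓ))
      (h1 : (∑ t ∈ Finset.univ.filter (fun t => t < ℓ), n (σ⁻¹ t)) + m < N),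
      (β' ⟨(∑ t ∈ Finset.univ.filter (fun t => t < ℓ), n (σ⁻¹ t)) + m, h1⟩ : ℕ) =
        (∑ t ∈ Finset.univ.filter (fun t => t < ℓ), n (σ⁻¹ t)) + (π (σ⁻¹ ℓ) ⟨m, hm⟩ : ℕ)) :
    τ * β = β' * τ := by
  have hsum (ℓ : Fin k) : ∑ t ∈ Finset.univ.filter (fun t => σ t < σ ℓ), n t =
      ∑ t ∈ Finset.univ.filter (fun t => t < σ ℓ), n (σ⁻¹ t) :=
    Finset.sum_equiv σ (by simp) (by simp)
  have hβσ (ℓ : Fin k) (m : ℕ) (hm : m < n ℓ)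
      (h1 : (∑ t ∈ Finset.univ.filter (fun t => σ t < σ ℓ), n t) + m < N) :
      (β' ⟨(∑ t ∈ Finset.univ.filter (fun t => σ t < σ ℓ), n t) + m, h1⟩ : ℕ) =
        (∑ t ∈ Finset.univ.filter (fun t => σ t < σ ℓ), n t) + (π ℓ ⟨m, hm⟩ : ℕ) := by
    have h := hβ' (σ ℓ) m
    simp only [← hsum] at h
    generalize hj : σ⁻¹ (σ ℓ) = j at h
    obtain rfl : ℓ = j := by simpa using hj
    exact h hm h1
  ext ⟨i, hi⟩
  obtain ⟨ℓ, -, m, hm, rfl⟩ := exists_eq_sum_filter_lt_add n Finset.univ (hN ▸ hi)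
  have hβi := Fin.ext (b := ⟨_, hN ▸ sum_filter_lt_add_lt id n ℓ (π ℓ ⟨m, hm⟩).isLt⟩)
    (hβ ℓ m hm hi)
  have hτi := Fin.ext (b := ⟨_, hN ▸ sum_filter_lt_add_lt σ n ℓ hm⟩) (hτ ℓ m hm hi)
  rw [Equiv.Perm.mul_apply, Equiv.Perm.mul_apply, hβi, hτi, hβσ ℓ m hm]
  exact hτ ℓ _ (π ℓ ⟨m, hm⟩).isLt _
end

section
/- Let G be a finite group and let U be a countable type with a G-action. Then the following are equivalent: (i) for every finite type X with a G-action there exists an injective G-equivariant map X → U; (ii) for every subgroup H of G, the set of elements u ∈ U whose stabilizer {g ∈ G | g·u = u} equals H is infinite. -/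
open MulAction

/-- Finitely many infinite sets have a system of distinct representatives. -/
theorem exists_injective_mem_of_infinite {ι α : Type*} [Finite ι] (S : ι → Set α)
    (hS : ∀ i, (S i).Infinite) : ∃ f : ι → α, Function.Injective f ∧ ∀ i, f i ∈ S i := by
  classical
  cases nonempty_fintype ι
  choose T hTS hT using fun i => (hS i).exists_subset_card_eq (Fintype.card ι)
  obtain ⟨f, hf, hfT⟩ := (Finset.all_card_le_biUnion_card_iff_exists_injective T).1 fun s => by
    rcases s.eq_empty_or_nonempty with rfl | ⟨i, hi⟩
    · simp
    · exact (s.card_le_univ.trans (hT i).ge).trans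
        (Finset.card_le_card (Finset.subset_biUnion_of_mem T hi))
  exact ⟨f, hf, fun i => hTS i (hfT i)⟩

/-- An infinite set in a `G`-set of a finite group meets infinitely many orbits. -/
theorem infinite_image_orbit {G U : Type*} [Group G] [Finite G] [MulAction G U]
    {S : Set U} (hS : S.Infinite) : ((fun u => orbit G u) '' S).Infinite := by
  intro h
  refine hS ((h.biUnion (t := id) ?_).subset fun u hu =>
    Set.mem_biUnion (Set.mem_image_of_mem _ hu) (mem_orbit_self u))
  rintro _ ⟨u, -, rfl⟩
  exact Set.finite_range _

/-- A choice of points in distinct orbits, one for each orbit of `X` and with the same stabilizer as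
a representative of it, extends to an injective equivariant map. -/
theorem exists_injective_equivariant {G X U : Type*} [Group G] [MulAction G X] [MulAction G U]
    (u : orbitRel.Quotient G X → U) (hu : ∀ ω, stabilizer G (u ω) = stabilizer G ω.out)
    (horb : Function.Injective fun ω => orbit G (u ω)) :
    ∃ f : X → U, Function.Injective f ∧ ∀ (g : G) (x : X), f (g • x) = g • f x := by
  have hrep (x : X) : ∃ g : G, g • (Quotient.mk (orbitRel G X) x).out = x :=
    orbitRel_apply.1 ((orbitRel G X).symm (Quotient.mk_out (s := orbitRel G X) x))
  choose c hc using hrep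
  have key (ω : orbitRel.Quotient G X) (g h : G) : g • u ω = h • u ω ↔ g • ω.out = h • ω.out := by
    have := SetLike.ext_iff.1 (hu ω) (h⁻¹ * g)
    simpa only [mem_stabilizer_iff, mul_smul, inv_smul_eq_iff] using this
  refine ⟨fun x => c x • u (Quotient.mk _ x), fun x y hxy => ?_, fun g x => ?_⟩
  · have hq : Quotient.mk (orbitRel G X) x = Quotient.mk _ y := horb <| by
      simpa only [orbit_smul] using congrArg (orbit G) hxy
    have hxy' : c x • u (Quotient.mk _ x) = c y • u (Quotient.mk _ y) := hxy
    rw [← hq, key, hc, hq, hc] at hxy'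
    exact hxy'
  · have hq : Quotient.mk (orbitRel G X) (g • x) = Quotient.mk _ x :=
      Quotient.sound (orbitRel_apply.2 (mem_orbit x g))
    have h1 := hc (g • x)
    rw [hq] at h1
    simp only [hq]
    rw [← mul_smul, key, h1, mul_smul, hc]

/-- An injective equivariant map preserves stabilizers. -/
theorem stabilizer_apply_of_injective {G X U : Type*} [Group G] [MulAction G X] [MulAction G U]
    {f : X → U} (hf : Function.Injective f) (hfG : ∀ (g : G) (x : X), f (g • x) = g • f x) (x : X) :
    stabilizer G (f x) = stabilizer G x := by
  ext g
  rw [mem_stabilizer_iff, mem_stabilizer_iff, ← hfG, hf.eq_iff]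


/-- For a finite group `G` and a countable `G`-set `U`, `U` is a complete `G`-set
universe (every finite `G`-set embeds equivariantly into `U`) if and only if every
subgroup of `G` is the stabilizer of infinitely many elements of `U`. -/
theorem complete_universe_iff_stabilizers (G : Type) [Group G] [Fintype G]
    (U : Type) [Countable U] [MulAction G U] :
    (∀ (X : Type) [Fintype X] [MulAction G X],
        ∃ f : X → U, Function.Injective f ∧ ∀ (g : G) (x : X), f (g • x) = g • f x) ↔
      (∀ H : Subgroup G, {u : U | MulAction.stabilizer G u = H}.Infinite) := by
  constructor
  · intro h H hfin
    classical
    let X := Σ _ : Fin (hfin.toFinset.card + 1), G ⧸ H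
    obtain ⟨f, hf, hfG⟩ := @h X (Fintype.ofFinite X) inferInstance
    let x (i : Fin (hfin.toFinset.card + 1)) : X := ⟨i, (1 : G)⟩
    have hx : Function.Injective x := fun i j hij => congrArg Sigma.fst hij
    have hstab (i) : stabilizer G (f (x i)) = H :=
      (stabilizer_apply_of_injective hf hfG _).trans <|
        (stabilizer_apply_of_injective (f := Sigma.mk i) sigma_mk_injective (fun _ _ => rfl) _).trans
          (stabilizer_quotient H)
    have hcard := Finset.card_le_card_of_injOn (s := Finset.univ) (t := hfin.toFinset)
      (fun i => f (x i)) (fun i _ => by simpa using hstab i) (hf.comp hx).injOn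
    simp at hcard
  · intro h X _ _
    have : Finite (orbitRel.Quotient G X) := Quotient.finite _
    obtain ⟨F, hF, hmem⟩ := exists_injective_mem_of_infinite _
      fun ω : orbitRel.Quotient G X => infinite_image_orbit (G := G) (h (stabilizer G ω.out))
    choose u hu huF using hmem
    refine exists_injective_equivariant u hu ?_
    rwa [show (fun ω => orbit G (u ω)) = F from funext huF]
end

section
/- Let G be a finite group acting on ℕ such that for every finite type X with a G-action there exists an injective G-equivariant map X → ℕ. Let S be a finite subset of ℕ that is G-invariant (g·s ∈ S for all g ∈ G and s ∈ S). Then for every finite type X with a G-action there exists an injective G-equivariant map f : X → ℕ such that f(x) ∉ S for all x ∈ X. -/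
/-- Removing a finite `G`-invariant subset from a complete `G`-set universe structure
on `ℕ` still leaves a complete `G`-set universe: every finite `G`-set embeds
equivariantly into the complement. -/
theorem complete_universe_avoid_finite (G : Type) [Group G] [Fintype G] [MulAction G ℕ]
    (huniv : ∀ (X : Type) [Fintype X] [MulAction G X],
      ∃ f : X → ℕ, Function.Injective f ∧ ∀ (g : G) (x : X), f (g • x) = g • f x)
    (S : Finset ℕ) (hS : ∀ (g : G), ∀ s ∈ S, g • s ∈ S) :
    ∀ (X : Type) [Fintype X] [MulAction G X],
      ∃ f : X → ℕ, Function.Injective f ∧ (∀ (g : G) (x : X), f (g • x) = g • f x) ∧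
        ∀ x : X, f x ∉ S := by
  intro X _ _
  let copies : MulAction G (X × Fin (S.card + 1)) :=
    { smul := fun g p => (g • p.1, p.2)
      one_smul := fun p => Prod.ext (one_smul G p.1) rfl
      mul_smul := fun g h p => Prod.ext (mul_smul g h p.1) rfl }
  obtain ⟨f, hf, hfG⟩ := huniv (X × Fin (S.card + 1))
  -- One of the `S.card + 1` disjoint copies of `X` misses `S`, by pigeonhole.
  obtain ⟨i, hi⟩ : ∃ i, ∀ x, f (x, i) ∉ S := by
    by_contra! h
    choose x hx using h
    have hcard := Finset.card_le_card_of_injOn (s := Finset.univ) (t := S)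
      (fun i => f (x i, i)) (fun i _ => hx i) (fun i _ j _ hij => congrArg Prod.snd (hf hij))
    simp at hcard
  exact ⟨fun x => f (x, i), fun x y h => congrArg Prod.fst (hf h), fun g x => hfG g (x, i), hi⟩
end

section
/- For every finite group G there exists an injective group homomorphism ρ : G → Equiv.Perm ℕ such that, for the G-action on ℕ given by g·n = ρ(g)(n), every finite type X with a G-action admits an injective G-equivariant map X → ℕ. -/
open scoped Pointwise in
/-- The action of `G` on `ℕ × Set G` by left translation of the second coordinate. -/
def translationPerm (G : Type*) [Group G] : G →* Equiv.Perm (ℕ × Set G) where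
  toFun g := (Equiv.refl ℕ).prodCongr (MulAction.toPerm g)
  map_one' := by ext1 ⟨n, s⟩; simp
  map_mul' g h := by ext1 ⟨n, s⟩; simp [mul_smul]

open scoped Pointwise in
theorem translationPerm_apply {G : Type*} [Group G] (g : G) (p : ℕ × Set G) :
    translationPerm G g p = (p.1, g • p.2) := rfl

theorem translationPerm_injective (G : Type*) [Group G] :
    Function.Injective (translationPerm G) := by
  intro g h hgh
  simpa [translationPerm_apply] using DFunLike.congr_fun hgh (0, {1})

open scoped Pointwise in
/-- Send `x` to the index of a representative `y` of its orbit, together with the coset of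
elements moving `y` to `x`. -/
theorem exists_equivariant_embedding_translationPerm (G X : Type*) [Group G] [Countable X]
    [MulAction G X] :
    ∃ f : X → ℕ × Set G, Function.Injective f ∧
      ∀ (g : G) (x : X), f (g • x) = translationPerm G g (f x) := by
  obtain ⟨i, hi⟩ := exists_injective_nat X
  let r : X → X := fun x ↦ (Quotient.mk (MulAction.orbitRel G X) x).out
  have hr (x : X) : ∃ g : G, g • r x = x :=
    (MulAction.orbitRel G X).symm (Quotient.mk_out (s := MulAction.orbitRel G X) x)
  have hrg (g : G) (x : X) : r (g • x) = r x :=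
    congrArg Quotient.out (Quotient.sound ⟨g, rfl⟩)
  refine ⟨fun x ↦ (i (r x), {g | g • r x = x}), fun x y hxy ↦ ?_, fun g x ↦ ?_⟩
  · obtain ⟨h₁, h₂⟩ := Prod.mk.inj hxy
    obtain ⟨g, hg⟩ := hr x
    have hy : g • r y = y := (Set.ext_iff.mp h₂ g).mp hg
    rw [← hg, ← hy, hi h₁]
  · simp only [translationPerm_apply, hrg]
    congr 1
    ext k
    simp [Set.mem_smul_set_iff_inv_smul_mem, mul_smul, inv_smul_eq_iff]

/-- Every finite group admits a faithful action on `ℕ` making `ℕ` a complete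
`G`-set universe. -/
theorem exists_universal_embedding (G : Type) [Group G] [Fintype G] :
    ∃ ρ : G →* Equiv.Perm ℕ, Function.Injective ρ ∧
      ∀ (X : Type) [Fintype X] [MulAction G X],
        ∃ f : X → ℕ, Function.Injective f ∧ ∀ (g : G) (x : X), f (g • x) = ρ g (f x) := by
  obtain ⟨e⟩ := nonempty_equiv_of_countable (α := ℕ × Set G) (β := ℕ)
  refine ⟨e.permCongrHom.toMonoidHom.comp (translationPerm G),
    e.permCongrHom.injective.comp (translationPerm_injective G), fun X _ _ ↦ ?_⟩
  obtain ⟨f, hf, hfg⟩ := exists_equivariant_embedding_translationPerm G X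
  exact ⟨e ∘ f, e.injective.comp hf, fun g x ↦ by simp [hfg, Equiv.permCongrHom]⟩
end

section
/- Let G be a finite group and let ρ₁, ρ₂ : G → Equiv.Perm ℕ be group homomorphisms such that for each of the two induced G-actions on ℕ, every finite type X with a G-action admits an injective G-equivariant map X → ℕ. Then there exists a bijection w : ℕ ≃ ℕ such that w(ρ₁(g)(n)) = ρ₂(g)(w(n)) for all g ∈ G and n ∈ ℕ. -/
open MulAction in
/-- An equivariant bijection between `G`-sets, built from a bijection of orbits that lifts to base
points with equal stabilizers. -/
theorem exists_equivariant_equiv_of_orbit_equiv {G X Y : Type*} [Group G] [MulAction G X]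
    [MulAction G Y] (e : orbitRel.Quotient G X ≃ orbitRel.Quotient G Y)
    (x₀ : orbitRel.Quotient G X → X) (y₀ : orbitRel.Quotient G X → Y)
    (hx₀ : ∀ ω, (Quotient.mk'' (x₀ ω) : orbitRel.Quotient G X) = ω)
    (hy₀ : ∀ ω, (Quotient.mk'' (y₀ ω) : orbitRel.Quotient G Y) = e ω)
    (hstab : ∀ ω, stabilizer G (x₀ ω) = stabilizer G (y₀ ω)) :
    ∃ w : X ≃ Y, ∀ (g : G) (x : X), w (g • x) = g • w x := by
  have smul_eq_iff (ω) (a b : G) : a • x₀ ω = b • x₀ ω ↔ a • y₀ ω = b • y₀ ω := by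
    have h := SetLike.ext_iff.1 (hstab ω) (b⁻¹ * a)
    simpa only [mem_stabilizer_iff, mul_smul, inv_smul_eq_iff] using h
  have mk_smul_x (g : G) (x : X) :
      (Quotient.mk'' (g • x) : orbitRel.Quotient G X) = Quotient.mk'' x :=
    Quotient.sound ⟨g, rfl⟩
  have mk_smul_y (g : G) (y : Y) :
      (Quotient.mk'' (g • y) : orbitRel.Quotient G Y) = Quotient.mk'' y :=
    Quotient.sound ⟨g, rfl⟩
  have exists_smul (x : X) : ∃ g : G, g • x₀ (Quotient.mk'' x) = x :=
    Quotient.exact (hx₀ (Quotient.mk'' x)).symm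
  choose γ hγ using exists_smul
  let w (x : X) : Y := γ x • y₀ (Quotient.mk'' x)
  have w_smul_base (ω) (g : G) : w (g • x₀ ω) = g • y₀ ω := by
    have hω : (Quotient.mk'' (g • x₀ ω) : orbitRel.Quotient G X) = ω := by rw [mk_smul_x, hx₀]
    have := hγ (g • x₀ ω)
    simp only [w]
    rw [hω] at this ⊢
    exact (smul_eq_iff ω _ _).1 this
  have mk_w (x : X) : (Quotient.mk'' (w x) : orbitRel.Quotient G Y) = e (Quotient.mk'' x) := by
    rw [← hy₀, mk_smul_y]
  refine ⟨Equiv.ofBijective w ⟨fun x x' h => ?_, fun y => ?_⟩, fun g x => ?_⟩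
  · have hω : (Quotient.mk'' x : orbitRel.Quotient G X) = Quotient.mk'' x' :=
      e.injective (by rw [← mk_w, ← mk_w, h])
    rw [← hγ x, ← hγ x', hω, smul_eq_iff]
    simpa only [w, hω] using h
  · obtain ⟨g, hg⟩ : ∃ g : G, g • y₀ (e.symm (Quotient.mk'' y)) = y :=
      Quotient.exact (by simpa using (hy₀ (e.symm (Quotient.mk'' y))).symm)
    exact ⟨g • x₀ _, by rw [w_smul_base, hg]⟩
  · change w (g • x) = g • γ x • y₀ _
    conv_lhs => rw [← hγ x]
    rw [smul_smul, w_smul_base, smul_smul]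

open Pointwise in
/-- The conjugacy class of the stabilizer of any point of an orbit. -/
def orbitStabilizerClass (G X : Type*) [Group G] [MulAction G X] :
    MulAction.orbitRel.Quotient G X → MulAction.orbitRel.Quotient (ConjAct G) (Subgroup G) :=
  Quotient.lift (fun x => Quotient.mk'' (MulAction.stabilizer G x)) (by
    rintro _ x ⟨g, rfl⟩
    exact Quotient.sound ⟨ConjAct.toConjAct g,
      (MulAction.stabilizer_smul_eq_stabilizer_map_conj g x).symm⟩)

open MulAction Pointwise in
/-- Every conjugacy class of subgroups is the stabilizer class of infinitely many orbits of a
complete `G`-set universe. -/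
theorem infinite_orbitStabilizerClass_fiber {G : Type} {U : Type*} [Group G] [Finite G]
    [MulAction G U]
    (hU : ∀ (X : Type) [Fintype X] [MulAction G X],
      ∃ f : X → U, Function.Injective f ∧ ∀ (g : G) (x : X), f (g • x) = g • f x)
    (c : orbitRel.Quotient (ConjAct G) (Subgroup G)) :
    Infinite {ω // orbitStabilizerClass G U ω = c} := by
  induction c using Quotient.inductionOn with | _ H
  refine not_finite_iff_infinite.1 fun hfin => ?_
  let n := Nat.card {ω // orbitStabilizerClass G U ω = Quotient.mk _ H}
  let act : MulAction G (Fin (n + 1) × (G ⧸ H)) :=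
    { smul := fun g p => (p.1, g • p.2)
      one_smul := fun p => Prod.ext rfl (one_smul G p.2)
      mul_smul := fun a b p => Prod.ext rfl (mul_smul a b p.2) }
  have smul_def (g : G) (p : Fin (n + 1) × (G ⧸ H)) : g • p = (p.1, g • p.2) := rfl
  have := Fintype.ofFinite (Fin (n + 1) × (G ⧸ H))
  obtain ⟨f, hf, hfG⟩ := hU (Fin (n + 1) × (G ⧸ H))
  have hstab (i : Fin (n + 1)) : stabilizer G (f (i, ((1 : G) : G ⧸ H))) = H := by
    ext g
    rw [mem_stabilizer_iff, ← hfG, hf.eq_iff, smul_def, Prod.mk.injEq]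
    rw [← mem_stabilizer_iff, stabilizer_quotient]
    simp
  let F (i : Fin (n + 1)) : {ω // orbitStabilizerClass G U ω = Quotient.mk _ H} :=
    ⟨Quotient.mk'' (f (i, ((1 : G) : G ⧸ H))), congrArg (Quotient.mk _) (hstab i)⟩
  have hF : Function.Injective F := fun i j h => by
    obtain ⟨g, hg⟩ := Quotient.exact (congrArg Subtype.val h)
    exact (congrArg Prod.fst (hf ((hfG g _).trans hg))).symm
  have := Nat.card_le_card_of_injective F hF
  simp [n] at this

open MulAction Pointwise in
/-- Two complete `G`-set universes are equivariantly isomorphic. -/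
theorem exists_equivariant_equiv_of_complete_universes {G : Type} {U V : Type*} [Group G]
    [Finite G] [Countable U] [Countable V] [MulAction G U] [MulAction G V]
    (hU : ∀ (X : Type) [Fintype X] [MulAction G X],
      ∃ f : X → U, Function.Injective f ∧ ∀ (g : G) (x : X), f (g • x) = g • f x)
    (hV : ∀ (X : Type) [Fintype X] [MulAction G X],
      ∃ f : X → V, Function.Injective f ∧ ∀ (g : G) (x : X), f (g • x) = g • f x) :
    ∃ w : U ≃ V, ∀ (g : G) (u : U), w (g • u) = g • w u := by
  have : Countable (orbitRel.Quotient G U) := Quotient.countable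
  have : Countable (orbitRel.Quotient G V) := Quotient.countable
  have fiber_equiv (c : orbitRel.Quotient (ConjAct G) (Subgroup G)) :
      Nonempty ({ω // orbitStabilizerClass G U ω = c} ≃
        {ω // orbitStabilizerClass G V ω = c}) := by
    have := infinite_orbitStabilizerClass_fiber hU c
    have := infinite_orbitStabilizerClass_fiber hV c
    exact nonempty_equiv_of_countable
  let e := Equiv.ofFiberEquiv fun c => (fiber_equiv c).some
  have he (ω) : orbitStabilizerClass G V (e ω) = orbitStabilizerClass G U ω :=
    Equiv.ofFiberEquiv_map _ ω
  have exists_base (ω : orbitRel.Quotient G U) : ∃ v : V,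
      (Quotient.mk'' v : orbitRel.Quotient G V) = e ω ∧
        stabilizer G ω.out = stabilizer G v := by
    have hω := he ω
    obtain ⟨v, hv⟩ := Quotient.exists_rep (e ω)
    rw [← hv, ← Quotient.out_eq ω] at hω
    obtain ⟨g, hg⟩ := Quotient.exact hω.symm
    refine ⟨ConjAct.ofConjAct g • v, ?_, ?_⟩
    · rw [← hv]
      exact Quotient.sound ⟨_, rfl⟩
    · rw [stabilizer_smul_eq_stabilizer_map_conj]
      exact hg.symm
  choose v₀ hv₀ hstab using exists_base
  exact exists_equivariant_equiv_of_orbit_equiv e Quotient.out v₀ Quotient.out_eq hv₀ hstab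


/-- Any two complete `G`-set universe structures on `ℕ` are `G`-equivariantly
isomorphic: two actions of a finite group `G` on `ℕ`, each making `ℕ` a complete
`G`-set universe, differ by conjugation with a bijection of `ℕ`. -/
theorem universal_embeddings_conjugate (G : Type) [Group G] [Fintype G]
    (ρ₁ ρ₂ : G →* Equiv.Perm ℕ)
    (h₁ : ∀ (X : Type) [Fintype X] [MulAction G X],
      ∃ f : X → ℕ, Function.Injective f ∧ ∀ (g : G) (x : X), f (g • x) = ρ₁ g (f x))
    (h₂ : ∀ (X : Type) [Fintype X] [MulAction G X],
      ∃ f : X → ℕ, Function.Injective f ∧ ∀ (g : G) (x : X), f (g • x) = ρ₂ g (f x)) :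
    ∃ w : ℕ ≃ ℕ, ∀ (g : G) (n : ℕ), w (ρ₁ g n) = ρ₂ g (w n) := by
  exact @exists_equivariant_equiv_of_complete_universes G ℕ ℕ _ _ _ _
    (MulAction.compHom ℕ ρ₁) (MulAction.compHom ℕ ρ₂) h₁ h₂
end
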